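/- Let ℓ, ℓ' be geodesic lines of ℍ with endpoints ξ₊, ξ₋ and ξ'₊, ξ'₋ respectively, and let g, g' ∈ PSL(2,ℝ). If the right AdS crooked planes g·C*(ℓ) and g'·C*(ℓ') are disjoint, then ℓ and ℓ' have disjoint closures in ℍ ∪ ∂∞ℍ; that is, ℓ ∩ ℓ' = ∅ and {ξ₊, ξ₋} ∩ {ξ'₊, ξ'₋} = ∅. -/

import Mathlib

noncomputable section

open Filter Topology Pointwise
open scoped UpperHalfPlane

/-- `SL(2,ℝ)`. -/
abbrev SL2 := Matrix.SpecialLinearGroup (Fin 2) ℝ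

instance : TopologicalSpace SL2 :=
  TopologicalSpace.induced (fun A : SL2 => (A : Matrix (Fin 2) (Fin 2) ℝ)) inferInstance

/-- `PSL(2,ℝ) = SL(2,ℝ)/{±I}`. -/
abbrev PSL2 := SL2 ⧸ Subgroup.center SL2

/-- The Möbius action of an element of `PSL(2,ℝ)` on the upper half-plane,
computed via an (arbitrary) lift to `SL(2,ℝ)`; this is well defined since
`-I` acts trivially. -/
def pslSMul (g : PSL2) (z : ℍ) : ℍ := (Quotient.out g) • z

/-- Image of a subset of `ℍ` under the Möbius action of `g ∈ PSL(2,ℝ)`. -/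
def pslImg (g : PSL2) (s : Set ℍ) : Set ℍ := pslSMul g '' s

/-- A geodesic line of `ℍ`: the image of an isometric embedding of `ℝ` into `ℍ`. -/
def IsGeodesicLine (l : Set ℍ) : Prop := ∃ γ : ℝ → ℍ, Isometry γ ∧ Set.range γ = l

/-- The embedding of `ℍ` into the one-point compactification of `ℂ`. -/
def embH (z : ℍ) : OnePoint ℂ := ((z : ℂ) : OnePoint ℂ)

/-- The embedding of `∂∞ℍ = ℝ ∪ {∞}` into the one-point compactification of `ℂ`. -/
def toC : OnePoint ℝ → OnePoint ℂ := OnePoint.map Complex.ofReal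

/-- The vector `v(ξ) ∈ ℝ²` associated with a boundary point `ξ ∈ ℝ ∪ {∞}`:
`v(ξ) = (ξ, 1)` for `ξ ∈ ℝ` and `v(∞) = (1, 0)`. -/
def bvec (ξ : OnePoint ℝ) : Fin 2 → ℝ := Option.elim ξ ![1, 0] (fun r => ![r, 1])

/-- The extended Möbius action of `PSL(2,ℝ)` on `∂∞ℍ = ℝ ∪ {∞}`. -/
def bdSMul (g : PSL2) (ξ : OnePoint ℝ) : OnePoint ℝ :=
  let w := ((Quotient.out g : SL2) : Matrix (Fin 2) (Fin 2) ℝ).mulVec (bvec ξ)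
  if w 1 = 0 then OnePoint.infty else ((w 0 / w 1 : ℝ) : OnePoint ℝ)

/-- `ξ ∈ ℝ ∪ {∞}` is an endpoint of the geodesic line `l`: some isometric
parametrization of `l` tends to `ξ` (in the one-point compactification of `ℂ`). -/
def IsEndpoint (l : Set ℍ) (ξ : OnePoint ℝ) : Prop :=
  ∃ γ : ℝ → ℍ, Isometry γ ∧ Set.range γ = l ∧
    Tendsto (fun t => embH (γ t)) atTop (𝓝 (toC ξ))

/-- `h ∈ PSL(2,ℝ)` has a nonattracting fixed point at `ξ ∈ ℝ ∪ {∞}`. -/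
def HasNonattracting (h : PSL2) (ξ : OnePoint ℝ) : Prop :=
  ∃ A : SL2, (QuotientGroup.mk A : PSL2) = h ∧
    ∃ μ : ℝ, |μ| ≤ 1 ∧ (A : Matrix (Fin 2) (Fin 2) ℝ).mulVec (bvec ξ) = μ • bvec ξ

/-- `h ∈ PSL(2,ℝ)` has a nonrepelling fixed point at `ξ ∈ ℝ ∪ {∞}`. -/
def HasNonrepelling (h : PSL2) (ξ : OnePoint ℝ) : Prop :=
  ∃ A : SL2, (QuotientGroup.mk A : PSL2) = h ∧
    ∃ μ : ℝ, 1 ≤ |μ| ∧ (A : Matrix (Fin 2) (Fin 2) ℝ).mulVec (bvec ξ) = μ • bvec ξ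

/-- The right AdS crooked plane `C*(l)` centered at the identity. -/
def rightCrooked (l : Set ℍ) : Set PSL2 :=
  {h | (∃ x ∈ l, pslSMul h x = x) ∨ ∃ ξ, IsEndpoint l ξ ∧ HasNonattracting h ξ}

/-- The left AdS crooked plane `C(l)` centered at the identity. -/
def leftCrooked (l : Set ℍ) : Set PSL2 :=
  {h | (∃ x ∈ l, pslSMul h x = x) ∨ ∃ ξ, IsEndpoint l ξ ∧ HasNonrepelling h ξ}

/-- A general right AdS crooked plane: a set of the form `g·C*(l)`. -/
def IsRightCrookedPlane (S : Set PSL2) : Prop :=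
  ∃ (g : PSL2) (l : Set ℍ), IsGeodesicLine l ∧ S = (g * ·) '' rightCrooked l

/-- A general left AdS crooked plane: a set of the form `C(l)·g`. -/
def IsLeftCrookedPlane (S : Set PSL2) : Prop :=
  ∃ (g : PSL2) (l : Set ℍ), IsGeodesicLine l ∧ S = (· * g) '' leftCrooked l

variable {Γ : Type*} [Group Γ]

/-- The action `γ·x = ρ(γ) x j(γ)⁻¹` of `Γ` on `PSL(2,ℝ)`, applied to a set. -/
def actImg (j ρ : Γ →* PSL2) (γ : Γ) (S : Set PSL2) : Set PSL2 :=
  (fun x => ρ γ * x * (j γ)⁻¹) '' S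

/-- The action `γ·x = ρ(γ) x j(γ)⁻¹` is properly discontinuous. -/
def ProperlyDisc (j ρ : Γ →* PSL2) : Prop :=
  ∀ K : Set PSL2, IsCompact K → {γ : Γ | (actImg j ρ γ K ∩ K).Nonempty}.Finite

/-- `R` is a fundamental domain for the action `γ·x = ρ(γ) x j(γ)⁻¹`:
`R` is closed, its translates cover `PSL(2,ℝ)`, and the interiors of the
translates are pairwise disjoint. -/
def IsFundDom (j ρ : Γ →* PSL2) (R : Set PSL2) : Prop :=
  IsClosed R ∧ (⋃ γ : Γ, actImg j ρ γ R) = Set.univ ∧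
    Pairwise fun γ₁ γ₂ : Γ =>
      Disjoint (interior (actImg j ρ γ₁ R)) (interior (actImg j ρ γ₂ R))

/-- The action admits a fundamental domain bounded by pairwise disjoint
right AdS crooked planes. -/
def AdmitsRightCrookedFD (j ρ : Γ →* PSL2) : Prop :=
  ∃ (m : ℕ) (D : Fin m → Set PSL2), (∀ i, IsRightCrookedPlane (D i)) ∧
    (∀ (γ γ' : Γ) (i i' : Fin m),
      actImg j ρ γ (D i) = actImg j ρ γ' (D i') ∨
      Disjoint (actImg j ρ γ (D i)) (actImg j ρ γ' (D i'))) ∧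
    ∃ x ∈ (⋃ (γ : Γ) (i : Fin m), actImg j ρ γ (D i))ᶜ,
      IsFundDom j ρ
        (closure (connectedComponentIn (⋃ (γ : Γ) (i : Fin m), actImg j ρ γ (D i))ᶜ x))

/-- The action admits a fundamental domain bounded by pairwise disjoint
left AdS crooked planes. -/
def AdmitsLeftCrookedFD (j ρ : Γ →* PSL2) : Prop :=
  ∃ (m : ℕ) (D : Fin m → Set PSL2), (∀ i, IsLeftCrookedPlane (D i)) ∧
    (∀ (γ γ' : Γ) (i i' : Fin m),
      actImg j ρ γ (D i) = actImg j ρ γ' (D i') ∨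
      Disjoint (actImg j ρ γ (D i)) (actImg j ρ γ' (D i'))) ∧
    ∃ x ∈ (⋃ (γ : Γ) (i : Fin m), actImg j ρ γ (D i))ᶜ,
      IsFundDom j ρ
        (closure (connectedComponentIn (⋃ (γ : Γ) (i : Fin m), actImg j ρ γ (D i))ᶜ x))

/-- The translation length `λ(g) = inf_{p ∈ ℍ} d(p, g·p)`. -/
def transLength (g : PSL2) : ℝ := ⨅ p : ℍ, dist p (pslSMul g p)

/-- `U` is a connected component of `S`. -/
def IsCC (S U : Set ℍ) : Prop := ∃ x ∈ S, connectedComponentIn S x = U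

/-- `ξ ∈ ℝ ∪ {∞}` is an ideal point of `U ⊆ ℍ`: a limit of a sequence of points
of `U` in the one-point compactification of `ℂ`. -/
def IsIdealPoint (U : Set ℍ) (ξ : OnePoint ℝ) : Prop :=
  ∃ u : ℕ → ℍ, (∀ n, u n ∈ U) ∧ Tendsto (fun n => embH (u n)) atTop (𝓝 (toC ξ))

/-- The closed right crooked half-space `H̄*₊(l, U)`. -/
def closedRHS (l U : Set ℍ) : Set PSL2 :=
  {h | (∃ x ∈ l ∪ U, pslSMul h x = x) ∨ ∃ ξ, IsIdealPoint U ξ ∧ HasNonattracting h ξ}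

/-- The open right crooked half-space `H*₊(l, U)`. -/
def openRHS (l U : Set ℍ) : Set PSL2 :=
  {h | h ≠ 1 ∧ ((∃ x ∈ U, pslSMul h x = x) ∨
    ∃ ξ, IsIdealPoint U ξ ∧ ¬ IsEndpoint l ξ ∧ HasNonattracting h ξ)}

/-- The circle of (Euclidean) radius `c` in `ℍ` centered at `0`; for suitable `c`
this is a geodesic line of `ℍ`. -/
def circ (c : ℝ) : Set ℍ := {z : ℍ | ‖(z : ℂ)‖ = c}

/-- The stem quadrant `SQ(ℓ)` for `ℓ = {|z| = 1/R}` transversely oriented towards `0`. -/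
def SQell (R : ℝ) : Set PSL2 :=
  {h | ∃ (A : SL2) (α β v : ℝ), (QuotientGroup.mk A : PSL2) = h ∧
    (A : Matrix (Fin 2) (Fin 2) ℝ) = !![α, -v/R; v*R, β] ∧
    |α| < |β| ∧ 2*|v| < |α - β|}

/-- The inverse stem quadrant `SQ(ℓ')⁻¹` for `ℓ' = {|z| = R}` transversely
oriented towards `∞`. -/
def SQell'inv (R : ℝ) : Set PSL2 :=
  {h | ∃ (A : SL2) (α β v : ℝ), (QuotientGroup.mk A : PSL2) = h ∧
    (A : Matrix (Fin 2) (Fin 2) ℝ) = !![α, v*R; -v/R, β] ∧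
    |α| < |β| ∧ 2*|v| < |α - β|}

/-- The stem quadrant `SQ(ℓ')`. -/
def SQell' (R : ℝ) : Set PSL2 := {h | h⁻¹ ∈ SQell'inv R}

/-- The point `i e^t`. -/
def ii (t : ℝ) : ℍ := ⟨⟨0, Real.exp t⟩, Real.exp_pos t⟩

lemma ii_re (t : ℝ) : (ii t).re = 0 := rfl
lemma ii_im (t : ℝ) : (ii t).im = Real.exp t := rfl

lemma sl_coe (A : SL2) (z : ℍ) : ((A • z : ℍ) : ℂ) =
    ((A 0 0 : ℂ) * z + (A 0 1 : ℂ)) / ((A 1 0 : ℂ) * z + (A 1 1 : ℂ)) := by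
  rw [UpperHalfPlane.coe_specialLinearGroup_apply]; rfl

lemma sl_det (A : SL2) : A 0 0 * A 1 1 - A 0 1 * A 1 0 = 1 := by
  have := A.det_coe
  rwa [Matrix.det_fin_two] at this

lemma sl_den (A : SL2) (z : ℍ) : ((A 1 0 : ℂ) * z + (A 1 1 : ℂ)) ≠ 0 := by
  intro h
  have h1 := congrArg Complex.im h
  have h2 := congrArg Complex.re h
  simp at h1 h2
  have hd := sl_det A
  have hz := z.im_ne_zero
  rcases h1 with h1 | h1
  · simp [h1] at h2
    rw [h1, h2] at hd; simp at hd
  · exact hz h1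

lemma sl_smul_iff (A : SL2) (z w : ℍ) : A • z = w ↔
    (A 0 0 : ℂ) * z + (A 0 1 : ℂ) = w * ((A 1 0 : ℂ) * z + (A 1 1 : ℂ)) := by
  rw [← UpperHalfPlane.coe_inj, sl_coe, div_eq_iff (sl_den A z)]

lemma central_smul (c : SL2) (hc : c ∈ Subgroup.center SL2) (z : ℍ) : c • z = z := by
  have h := Matrix.SpecialLinearGroup.scalar_eq_self_of_mem_center hc 0
  have h01 := congrFun (congrFun h 0) 1
  have h10 := congrFun (congrFun h 1) 0
  have h11 := congrFun (congrFun h 1) 1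
  simp at h01 h10 h11
  rw [sl_smul_iff, ← h01, ← h10, ← h11]
  simp; ring

lemma pslSMul_mk (A : SL2) (z : ℍ) : pslSMul (QuotientGroup.mk A : PSL2) z = A • z := by
  unfold pslSMul
  have h : (QuotientGroup.mk A : PSL2) = QuotientGroup.mk (Quotient.out (QuotientGroup.mk A : PSL2)) :=
    (QuotientGroup.out_eq' _).symm
  rw [QuotientGroup.eq] at h
  have := central_smul _ h z
  rw [mul_smul, inv_smul_eq_iff] at this
  exact this

lemma ii_smul_im (M : SL2) (s : ℝ) : (M • ii s).im =
    Real.exp s / ((M 1 0)^2 * (Real.exp s)^2 + (M 1 1)^2) := by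
  rw [← UpperHalfPlane.coe_im, sl_coe, Complex.div_im]
  have hd := sl_det M
  have : Complex.normSq ((M 1 0 : ℂ) * (ii s) + (M 1 1 : ℂ)) = 
      ((M 1 0)^2 * (Real.exp s)^2 + (M 1 1)^2) := by
    simp [Complex.normSq_apply, ii_re, ii_im]; ring
  rw [this]
  simp only [Complex.add_re, Complex.add_im, Complex.mul_re, Complex.mul_im, Complex.ofReal_re,
    Complex.ofReal_im, UpperHalfPlane.coe_re, UpperHalfPlane.coe_im, ii_re, ii_im]
  rw [← sub_div]; congr 1
  linear_combination Real.exp s * hd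

lemma ii_smul_re (M : SL2) (s : ℝ) : (M • ii s).re =
    (M 0 0 * M 1 0 * (Real.exp s)^2 + M 0 1 * M 1 1) /
      ((M 1 0)^2 * (Real.exp s)^2 + (M 1 1)^2) := by
  rw [← UpperHalfPlane.coe_re, sl_coe, Complex.div_re]
  have : Complex.normSq ((M 1 0 : ℂ) * (ii s) + (M 1 1 : ℂ)) = 
      ((M 1 0)^2 * (Real.exp s)^2 + (M 1 1)^2) := by
    simp [Complex.normSq_apply, ii_re, ii_im]; ring
  rw [this]
  simp only [Complex.add_re, Complex.add_im, Complex.mul_re, Complex.mul_im, Complex.ofReal_re,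
    Complex.ofReal_im, UpperHalfPlane.coe_re, UpperHalfPlane.coe_im, ii_re, ii_im]
  rw [← add_div]; congr 1
  ring

/-- Twice `p q cosh` of the distance. -/
def FF (M : SL2) (p q : ℝ) : ℝ :=
  (M 0 0)^2 * q^2 + (M 0 1)^2 + p^2 * ((M 1 0)^2 * q^2 + (M 1 1)^2)

lemma den_pos (M : SL2) (s : ℝ) : 0 < ((M 1 0)^2 * (Real.exp s)^2 + (M 1 1)^2) := by
  have hd := sl_det M
  by_cases h : M 1 0 = 0
  · have : M 1 1 ≠ 0 := by
      intro h1; rw [h, h1] at hd; simp at hd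
    positivity
  · have := Real.exp_pos s
    positivity

lemma cosh_FF (M : SL2) (t s : ℝ) : Real.cosh (dist (ii t) (M • ii s)) =
    FF M (Real.exp t) (Real.exp s) / (2 * Real.exp t * Real.exp s) := by
  rw [UpperHalfPlane.cosh_dist', ii_smul_im, ii_smul_re, ii_re, ii_im]
  have h := den_pos M s
  have hd := sl_det M
  have ht := Real.exp_pos t
  have hs := Real.exp_pos s
  unfold FF
  set D := ((M 1 0)^2 * (Real.exp s)^2 + (M 1 1)^2) with hD
  field_simp
  have key : (M 0 0 * M 1 0 * (Real.exp s)^2 + M 0 1 * M 1 1)^2 + (Real.exp s)^2 =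
     D * ((M 0 0)^2 * (Real.exp s)^2 + (M 0 1)^2) := by
    rw [hD]
    linear_combination (-(Real.exp s)^2 * (1 + (M 0 0 * M 1 1 - M 0 1 * M 1 0))) * hd
  linear_combination key

/-- Element of `SL(2,ℝ)` with given entries. -/
def mk2 (a b c d : ℝ) (h : a * d - b * c = 1) : SL2 :=
  ⟨!![a, b; c, d], by rw [Matrix.det_fin_two_of, h]⟩

@[simp] lemma mk2_00 (a b c d : ℝ) (h) : mk2 a b c d h 0 0 = a := rfl
@[simp] lemma mk2_01 (a b c d : ℝ) (h) : mk2 a b c d h 0 1 = b := rfl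
@[simp] lemma mk2_10 (a b c d : ℝ) (h) : mk2 a b c d h 1 0 = c := rfl
@[simp] lemma mk2_11 (a b c d : ℝ) (h) : mk2 a b c d h 1 1 = d := rfl

lemma rot_exists (z w : ℍ) (h : dist UpperHalfPlane.I z = dist UpperHalfPlane.I w) :
    ∃ R : SL2, R • UpperHalfPlane.I = UpperHalfPlane.I ∧ R • z = w := by
  have hc := congrArg Real.cosh h
  rw [UpperHalfPlane.cosh_dist', UpperHalfPlane.cosh_dist'] at hc
  have hz := z.im_pos
  have hw := w.im_pos
  simp only [UpperHalfPlane.I_re, UpperHalfPlane.I_im] at hc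
  field_simp at hc
  suffices ∃ a b : ℝ, a^2 + b^2 = 1 ∧ (a * (z - w) : ℂ) = b * (1 + z * w) by
    obtain ⟨a, b, hab, he⟩ := this
    refine ⟨mk2 a (-b) b a (by linarith), ?_, ?_⟩
    · rw [sl_smul_iff]
      simp
      linear_combination (-b : ℂ) * Complex.I_mul_I
    · rw [sl_smul_iff]
      simp
      linear_combination he
  by_cases h0 : (1 + z * w : ℂ) = 0
  · exact ⟨0, 1, by simp, by simp [h0]⟩
  · obtain ⟨r, hr⟩ : ∃ r : ℝ, ((z - w : ℂ) = r * (1 + z * w)) := by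
      refine ⟨((z - w : ℂ) / (1 + z * w)).re, ?_⟩
      rw [← div_eq_iff h0]
      apply Complex.ext
      · simp
      · rw [Complex.div_im]
        simp
        rw [← sub_div, div_eq_zero_iff]
        left
        linear_combination -hc
    have hp : 0 < 1 + r^2 := by positivity
    have hs := Real.sq_sqrt hp.le
    have hs' := Real.sqrt_pos.2 hp
    refine ⟨1 / √(1 + r^2), r / √(1 + r^2), ?_, ?_⟩
    · field_simp; rw [hs]
    · rw [hr]; push_cast; ring

lemma rot_exists' (x z w : ℍ) (h : dist x z = dist x w) :
    ∃ R : SL2, R • x = x ∧ R • z = w := by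
  obtain ⟨B, hB⟩ := MulAction.exists_smul_eq SL2 x UpperHalfPlane.I
  obtain ⟨R, h1, h2⟩ := rot_exists (B • z) (B • w) (by
    rw [← hB, dist_smul, dist_smul, h])
  refine ⟨B⁻¹ * R * B, ?_, ?_⟩
  · rw [mul_smul, mul_smul, hB, h1, ← hB, inv_smul_smul]
  · rw [mul_smul, mul_smul, h2, inv_smul_smul]

lemma geod_param (γ : ℝ → ℍ) (hγ : Isometry γ) : ∃ A : SL2, ∀ t, γ t = A • ii t := by
  have hii : ii 0 = UpperHalfPlane.I := by
    apply UpperHalfPlane.ext_re_im <;> simp [ii_re, ii_im]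
  obtain ⟨B, hB⟩ := MulAction.exists_smul_eq SL2 (γ 0) (ii 0)
  have hd : dist (ii 0) (ii 1) = 1 := by
    have h1 : Real.cosh (dist (ii 0) (ii 1)) = Real.cosh 1 := by
      rw [UpperHalfPlane.cosh_dist', ii_re, ii_im, ii_re, ii_im, Real.cosh_eq, Real.exp_neg]
      simp; field_simp
      rw [add_comm, ← Real.exp_nat_mul]; norm_num
    exact Real.cosh_strictMonoOn.injOn dist_nonneg (by simp : (0:ℝ) ≤ 1) h1
  obtain ⟨R, h1, h2⟩ := rot_exists' (ii 0) (B • γ 1) (ii 1) (by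
    rw [← hB, dist_smul, hγ.dist_eq, hB, hd]; simp)
  refine ⟨(R * B)⁻¹, fun t => ?_⟩
  rw [eq_inv_smul_iff]
  set z := (R * B) • γ t with hz
  have e0 : dist z (ii 0) = |t| := by
    have : ii 0 = (R * B) • γ 0 := by rw [mul_smul, hB, h1]
    rw [this, hz, dist_smul, hγ.dist_eq, Real.dist_eq, sub_zero]
  have e1 : dist z (ii 1) = |t - 1| := by
    have : ii 1 = (R * B) • γ 1 := by rw [mul_smul, h2]
    rw [this, hz, dist_smul, hγ.dist_eq, Real.dist_eq]
  replace e0 := congrArg Real.cosh e0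
  replace e1 := congrArg Real.cosh e1
  have hy := z.im_pos
  have ht := Real.exp_pos t
  have hE := Real.exp_pos 1
  have hE1 : 1 < Real.exp 1 := by rw [Real.one_lt_exp_iff]; norm_num
  rw [UpperHalfPlane.cosh_dist', ii_re, ii_im, Real.cosh_abs, Real.cosh_eq, Real.exp_neg, Real.exp_zero] at e0
  rw [UpperHalfPlane.cosh_dist', ii_re, ii_im, Real.cosh_abs, Real.cosh_eq, Real.exp_neg, Real.exp_sub] at e1
  field_simp at e0 e1
  set E := Real.exp 1
  set T := Real.exp t
  have hyT : z.im = T := by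
    have : (E^2 - 1) * (z.im - T) = 0 := by
      linear_combination e0 - e1
    rcases mul_eq_zero.1 this with h | h
    · nlinarith
    · linarith
  apply UpperHalfPlane.ext_re_im
  · rw [ii_re]
    have : T * z.re^2 = 0 := by
      rw [hyT] at e0
      linear_combination e0
    rcases mul_eq_zero.1 this with h | h
    · exact absurd h ht.ne'
    · exact pow_eq_zero_iff (two_ne_zero) |>.1 h
  · rw [hyT]; rfl
/-- The crooked plane of the imaginary axis, lifted to `SL(2,ℝ)`. -/
def RR (H : SL2) : Prop :=
  (∃ t, H • ii t = ii t) ∨ (H 1 0 = 0 ∧ |H 0 0| ≤ 1) ∨ (H 0 1 = 0 ∧ |H 1 1| ≤ 1)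

/-- The pair of crooked planes determined by `M, N` meet. -/
def PP (M N : SL2) : Prop := ∃ H H' : SL2, RR H ∧ RR H' ∧ H * M = N * H'

/-- The inversion. -/
def SS : SL2 := mk2 0 (-1) 1 0 (by norm_num)

lemma mul_00 (A B : SL2) : (A * B) 0 0 = A 0 0 * B 0 0 + A 0 1 * B 1 0 := by
  simp [Matrix.SpecialLinearGroup.coe_mul, Matrix.mul_apply, Fin.sum_univ_two]
lemma mul_01 (A B : SL2) : (A * B) 0 1 = A 0 0 * B 0 1 + A 0 1 * B 1 1 := by
  simp [Matrix.SpecialLinearGroup.coe_mul, Matrix.mul_apply, Fin.sum_univ_two]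
lemma mul_10 (A B : SL2) : (A * B) 1 0 = A 1 0 * B 0 0 + A 1 1 * B 1 0 := by
  simp [Matrix.SpecialLinearGroup.coe_mul, Matrix.mul_apply, Fin.sum_univ_two]
lemma mul_11 (A B : SL2) : (A * B) 1 1 = A 1 0 * B 0 1 + A 1 1 * B 1 1 := by
  simp [Matrix.SpecialLinearGroup.coe_mul, Matrix.mul_apply, Fin.sum_univ_two]

lemma inv_00 (A : SL2) : A⁻¹ 0 0 = A 1 1 := by
  simp [Matrix.SpecialLinearGroup.SL2_inv_expl]
lemma inv_01 (A : SL2) : A⁻¹ 0 1 = - A 0 1 := by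
  simp [Matrix.SpecialLinearGroup.SL2_inv_expl]
lemma inv_10 (A : SL2) : A⁻¹ 1 0 = - A 1 0 := by
  simp [Matrix.SpecialLinearGroup.SL2_inv_expl]
lemma inv_11 (A : SL2) : A⁻¹ 1 1 = A 0 0 := by
  simp [Matrix.SpecialLinearGroup.SL2_inv_expl]

lemma SS_ii (t : ℝ) : SS • ii t = ii (-t) := by
  rw [sl_smul_iff]
  have h : (Real.exp (-t)) * Real.exp t = 1 := by rw [← Real.exp_add]; simp
  apply Complex.ext <;> simp [SS, ii_re, ii_im, h]

lemma SS_inv_ii (t : ℝ) : SS⁻¹ • ii t = ii (-t) := by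
  rw [inv_smul_eq_iff, SS_ii, neg_neg]

lemma RR_conj {H : SL2} (h : RR H) : RR (SS⁻¹ * H * SS) := by
  rcases h with ⟨t, h⟩ | ⟨h1, h2⟩ | ⟨h1, h2⟩
  · exact Or.inl ⟨-t, by rw [mul_smul, mul_smul, SS_ii, neg_neg, h, SS_inv_ii]⟩
  · refine Or.inr (Or.inr ⟨?_, ?_⟩) <;>
      simp [mul_00, mul_01, mul_10, mul_11, inv_00, inv_01, inv_10, inv_11, SS, h1, h2]
  · refine Or.inr (Or.inl ⟨?_, ?_⟩) <;>
      simp [mul_00, mul_01, mul_10, mul_11, inv_00, inv_01, inv_10, inv_11, SS, h1, h2]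

lemma RR_conj' {H : SL2} (h : RR H) : RR (SS * H * SS⁻¹) := by
  rcases h with ⟨t, h⟩ | ⟨h1, h2⟩ | ⟨h1, h2⟩
  · exact Or.inl ⟨-t, by rw [mul_smul, mul_smul, SS_inv_ii, neg_neg, h, SS_ii]⟩
  · refine Or.inr (Or.inr ⟨?_, ?_⟩) <;>
      simp [mul_00, mul_01, mul_10, mul_11, inv_00, inv_01, inv_10, inv_11, SS, h1, h2]
  · refine Or.inr (Or.inl ⟨?_, ?_⟩) <;>
      simp [mul_00, mul_01, mul_10, mul_11, inv_00, inv_01, inv_10, inv_11, SS, h1, h2]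

lemma PP_left {M N : SL2} (h : PP (SS * M) (SS * N)) : PP M N := by
  obtain ⟨H, H', h1, h2, h3⟩ := h
  refine ⟨SS⁻¹ * H * SS, H', RR_conj h1, h2, ?_⟩
  calc SS⁻¹ * H * SS * M = SS⁻¹ * (H * (SS * M)) := by group
    _ = N * H' := by rw [h3]; group

lemma PP_right {M N : SL2} (h : PP (M * SS) (N * SS)) : PP M N := by
  obtain ⟨H, H', h1, h2, h3⟩ := h
  refine ⟨H, SS * H' * SS⁻¹, h1, RR_conj' h2, ?_⟩
  calc H * M = H * (M * SS) * SS⁻¹ := by group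
    _ = N * (SS * H' * SS⁻¹) := by rw [h3]; group

/-- Ideal-ideal intersection. -/
lemma ideal_10 (M N : SL2) (h0 : M 1 0 ≠ 0) (h : |M 1 0| ≤ |N 1 0|) : PP M N := by
  have hN : N 1 0 ≠ 0 := by
    intro hN; rw [hN, abs_zero] at h; exact h0 (abs_nonpos_iff.1 h)
  set x := (M 1 0 / N 1 0 * N 0 0 - M 0 0) / M 1 0 with hx
  have hx' : M 0 0 + x * M 1 0 = M 1 0 / N 1 0 * N 0 0 := by rw [hx]; field_simp; ring
  have hd := sl_det N
  refine ⟨mk2 1 x 0 1 (by ring), N⁻¹ * (mk2 1 x 0 1 (by ring) * M), ?_, ?_, ?_⟩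
  · right; left; simp
  · right; left
    constructor
    · simp only [mul_00, mul_10, inv_10, inv_11, mk2_00, mk2_01, mk2_10, mk2_11, one_mul,
        zero_mul, zero_add]
      rw [hx']; field_simp; ring
    · have : (N⁻¹ * (mk2 1 x 0 1 (by ring) * M)) 0 0 = M 1 0 / N 1 0 := by
        simp only [mul_00, mul_10, inv_00, inv_01, mk2_00, mk2_01, mk2_10, mk2_11, one_mul,
          zero_mul, zero_add]
        rw [hx']; field_simp; linear_combination hd
      rw [this, abs_div]
      exact div_le_one_of_le₀ h (abs_nonneg _)
  · group

lemma ideal_all (M N : SL2) (i j : Fin 2) (h0 : M i j ≠ 0) (h : |M i j| ≤ |N i j|) : PP M N := by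
  fin_cases i <;> fin_cases j <;> simp only [Fin.zero_eta, Fin.mk_one, Fin.isValue] at h0 h
  · apply PP_left
    apply ideal_10 <;> simpa [SS, mul_10]
  · apply PP_left
    apply PP_right
    apply ideal_10 <;> simpa [SS, mul_10, mul_11]
  · exact ideal_10 M N h0 h
  · apply PP_right
    apply ideal_10 <;> simpa [SS, mul_10]

/-- Interior-interior intersection. -/
lemma interior_case (M N : SL2) (p q : ℝ) (hp : 0 < p) (hq : 0 < q) (h : FF M p q = FF N p q) :
    PP M N := by
  obtain ⟨t, rfl⟩ : ∃ t, Real.exp t = p := ⟨Real.log p, Real.exp_log hp⟩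
  obtain ⟨s, rfl⟩ : ∃ t, Real.exp t = q := ⟨Real.log q, Real.exp_log hq⟩
  have h1 : Real.cosh (dist (ii t) (M • ii s)) = Real.cosh (dist (ii t) (N • ii s)) := by
    rw [cosh_FF, cosh_FF, h]
  have h2 := Real.cosh_strictMonoOn.injOn (dist_nonneg : 0 ≤ dist (ii t) (M • ii s))
    (dist_nonneg : 0 ≤ dist (ii t) (N • ii s)) h1
  obtain ⟨H, h3, h4⟩ := rot_exists' _ _ _ h2
  refine ⟨H, N⁻¹ * (H * M), Or.inl ⟨t, h3⟩, Or.inl ⟨s, ?_⟩, by group⟩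
  rw [mul_smul, mul_smul, h4, inv_smul_smul]

lemma zero_10 (M N : SL2) (h0 : M 1 0 = 0) : PP M N := by
  by_contra hP
  have key : ∀ i j, M i j ≠ 0 → |N i j| < |M i j| := fun i j h =>
    not_le.1 fun h' => hP (ideal_all M N i j h h')
  have hM := sl_det M
  have hN := sl_det N
  rw [h0, mul_zero, sub_zero] at hM
  have h00 : M 0 0 ≠ 0 := fun h => by rw [h] at hM; simp at hM
  have h11 : M 1 1 ≠ 0 := fun h => by rw [h] at hM; simp at hM
  have k0 := key 0 0 h00
  have k1 := key 1 1 h11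
  have hn : N 1 0 ≠ 0 := by
    intro hn
    rw [hn, mul_zero, sub_zero] at hN
    have e1 : |M 0 0| * |M 1 1| = 1 := by rw [← abs_mul, hM, abs_one]
    have e2 : |N 0 0| * |N 1 1| = 1 := by rw [← abs_mul, hN, abs_one]
    have := mul_lt_mul'' k0 k1 (abs_nonneg _) (abs_nonneg _)
    linarith
  have a0 : 0 < (M 0 0)^2 - (N 0 0)^2 := sub_pos.2 (sq_lt_sq.2 k0)
  have a1 : 0 < (M 1 1)^2 - (N 1 1)^2 := sub_pos.2 (sq_lt_sq.2 k1)
  have a2 : 0 < (N 1 0)^2 := by positivity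
  set A := (M 0 0)^2 - (N 0 0)^2
  set B := (M 1 1)^2 - (N 1 1)^2
  set C := (N 1 0)^2
  set D := (M 0 1)^2 - (N 0 1)^2
  -- solve  A Y + D + X (B - C Y) = 0
  set Y := B / C + |D| / A + 1 with hY
  have y0 : 0 < Y := by positivity
  have y1 : 0 < C * Y - B := by
    have : C * Y - B = C * (|D| / A + 1) := by rw [hY]; field_simp; ring
    rw [this]; positivity
  have y2 : 0 < A * Y + D := by
    have : A * Y + D = A * (B / C + 1) + (|D| + D) := by rw [hY]; field_simp; ring
    rw [this]
    have := neg_abs_le D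
    have : 0 < A * (B / C + 1) := by positivity
    linarith
  set X := (A * Y + D) / (C * Y - B) with hX
  have x0 : 0 < X := div_pos y2 y1
  have hXY : X * (C * Y - B) = A * Y + D := div_mul_cancel₀ _ y1.ne'
  refine hP (interior_case M N (√X) (√Y) (Real.sqrt_pos.2 x0) (Real.sqrt_pos.2 y0) ?_)
  unfold FF
  rw [Real.sq_sqrt x0.le, Real.sq_sqrt y0.le, h0]
  linear_combination -hXY

lemma zero_all (M N : SL2) (i j : Fin 2) (h0 : M i j = 0) : PP M N := by
  fin_cases i <;> fin_cases j <;> simp only [Fin.zero_eta, Fin.mk_one, Fin.isValue] at h0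
  · apply PP_left
    apply zero_10; simpa [SS, mul_10]
  · apply PP_left
    apply PP_right
    apply zero_10; simpa [SS, mul_10, mul_11]
  · exact zero_10 M N h0
  · apply PP_right
    apply zero_10; simpa [SS, mul_10]

lemma point_case (M N : SL2) (t s : ℝ) (h : M • ii s = ii t) : PP M N := by
  by_contra hP
  have hz : ∀ i j, M i j ≠ 0 := fun i j h => hP (zero_all M N i j h)
  have key : ∀ i j, (N i j)^2 < (M i j)^2 := fun i j => sq_lt_sq.2 <|
    not_le.1 fun h' => hP (ideal_all M N i j (hz i j) h')
  have h1 : Real.cosh (dist (ii t) (M • ii s)) ≤ Real.cosh (dist (ii t) (N • ii s)) := by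
    rw [h, dist_self, Real.cosh_zero]; exact Real.one_le_cosh _
  have ht := Real.exp_pos t
  have hs := Real.exp_pos s
  rw [cosh_FF, cosh_FF, div_le_div_iff_of_pos_right (by positivity)] at h1
  unfold FF at h1
  have k1 := mul_lt_mul_of_pos_right (key 0 0) (by positivity : 0 < (Real.exp s)^2)
  have k2 := key 0 1
  have k3 := mul_lt_mul_of_pos_right (key 1 0) (by positivity : 0 < (Real.exp s)^2)
  have k4 := key 1 1
  have k5 := mul_lt_mul_of_pos_left (add_lt_add k3 k4) (by positivity : 0 < (Real.exp t)^2)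
  linarith
lemma endpoint_vec (A : SL2) (ξ : OnePoint ℝ)
    (h : Tendsto (fun t => embH (A • ii t)) atTop (𝓝 (toC ξ))) :
    ∃ r : ℝ, r ≠ 0 ∧ A 0 0 = r * bvec ξ 0 ∧ A 1 0 = r * bvec ξ 1 := by
  have hd := sl_det A
  by_cases hc : A 1 0 = 0
  · have ha : A 0 0 ≠ 0 := fun h => by rw [h, hc] at hd; simp at hd
    have hdd : A 1 1 ≠ 0 := fun h => by rw [h, hc] at hd; simp at hd
    have hlim : Tendsto (fun t => embH (A • ii t)) atTop (𝓝 (OnePoint.infty : OnePoint ℂ)) := by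
      refine OnePoint.tendsto_coe_infty.comp ?_
      rw [Filter.coclosedCompact_eq_cocompact, ← Metric.cobounded_eq_cocompact,
        ← tendsto_norm_atTop_iff_cobounded]
      have h1 : Tendsto (fun t : ℝ => |A 0 0 / A 1 1| * Real.exp t) atTop atTop :=
        Real.tendsto_exp_atTop.const_mul_atTop (by positivity)
      refine tendsto_atTop_mono (fun t => ?_) h1
      refine le_trans (le_of_eq ?_) (Complex.abs_im_le_norm _)
      have him := ii_smul_im A t
      rw [UpperHalfPlane.coe_im, him, hc]
      have e : A 0 0 / A 1 1 = 1 / (A 1 1)^2 := by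
        field_simp; rw [hc] at hd; linarith
      have hp := Real.exp_pos t
      rw [e, abs_of_pos (by positivity), abs_of_pos (by positivity)]
      ring
    have hξ := tendsto_nhds_unique h hlim
    induction ξ using OnePoint.rec with
    | infty => exact ⟨A 0 0, ha, (mul_one _).symm, by
        rw [hc]; exact (mul_zero _).symm⟩
    | coe x => exact absurd hξ (OnePoint.coe_ne_infty _)
  · have hlim : Tendsto (fun t => embH (A • ii t)) atTop
        (𝓝 (((A 0 0 / A 1 0 : ℝ) : ℂ) : OnePoint ℂ)) := by
      refine (OnePoint.continuous_coe.tendsto _).comp ?_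
      have hcC : (A 1 0 : ℂ) ≠ 0 := by exact_mod_cast hc
      have e : ∀ t, ((A • ii t : ℍ) : ℂ) = ((A 0 0 / A 1 0 : ℝ) : ℂ) -
          1 / ((A 1 0 : ℂ) * ((A 1 0 : ℂ) * ii t + A 1 1)) := by
        intro t
        have hden := sl_den A (ii t)
        have hdC : (A 0 0 * A 1 1 - A 0 1 * A 1 0 : ℂ) = 1 := by exact_mod_cast hd
        rw [sl_coe]
        push_cast
        rw [div_eq_iff hden, sub_mul, one_div, mul_inv, mul_assoc, inv_mul_cancel₀ hden]
        field_simp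
        linear_combination -hdC
      simp only [e]
      have hz : Tendsto (fun t => 1 / ((A 1 0 : ℂ) * ((A 1 0 : ℂ) * ii t + A 1 1))) atTop (𝓝 0) := by
        simp only [one_div]
        refine tendsto_inv₀_cobounded.comp ?_
        rw [← tendsto_norm_atTop_iff_cobounded]
        have h1 : Tendsto (fun t : ℝ => (A 1 0)^2 * Real.exp t) atTop atTop :=
          Real.tendsto_exp_atTop.const_mul_atTop (by positivity)
        refine tendsto_atTop_mono (fun t => ?_) h1
        refine le_trans ?_ (Complex.abs_im_le_norm _)
        refine le_trans (le_of_eq ?_) (le_abs_self _)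
        simp [ii_im, ii_re]; ring
      simpa using tendsto_const_nhds.sub hz
    have hξ := tendsto_nhds_unique h hlim
    induction ξ using OnePoint.rec with
    | infty => exact absurd hξ.symm (OnePoint.coe_ne_infty _)
    | coe x =>
      have hx : x = A 0 0 / A 1 0 := by
        have h1 := OnePoint.coe_injective hξ
        exact_mod_cast h1
      refine ⟨A 1 0, hc, ?_, ?_⟩
      · change A 0 0 = A 1 0 * x
        rw [hx]; field_simp
      · change A 1 0 = A 1 0 * 1
        rw [mul_one]

lemma nonattr_of (B : SL2) (ξ : OnePoint ℝ) (a c r μ : ℝ) (hr : r ≠ 0) (ha : a = r * bvec ξ 0)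
    (hc : c = r * bvec ξ 1) (hμ : |μ| ≤ 1) (h0 : B 0 0 * a + B 0 1 * c = μ * a)
    (h1 : B 1 0 * a + B 1 1 * c = μ * c) : HasNonattracting (QuotientGroup.mk B : PSL2) ξ := by
  refine ⟨B, rfl, μ, hμ, ?_⟩
  subst ha hc
  ext i
  apply mul_left_cancel₀ hr
  fin_cases i
  · simp [Matrix.mulVec, dotProduct, Fin.sum_univ_two]
    left
    apply mul_left_cancel₀ hr
    linear_combination h0
  · simp [Matrix.mulVec, dotProduct, Fin.sum_univ_two]
    left
    apply mul_left_cancel₀ hr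
    linear_combination h1

lemma transfer (γ : ℝ → ℍ) (hγ : Isometry γ) (l : Set ℍ) (hrange : Set.range γ = l)
    (ξp ξm : OnePoint ℝ)
    (hξp : Tendsto (fun t => embH (γ t)) atTop (𝓝 (toC ξp)))
    (hξm : Tendsto (fun t => embH (γ t)) atBot (𝓝 (toC ξm))) :
    ∃ A : SL2, (∀ t, γ t = A • ii t) ∧
      (∃ r : ℝ, r ≠ 0 ∧ A 0 0 = r * bvec ξp 0 ∧ A 1 0 = r * bvec ξp 1) ∧
      (∃ r : ℝ, r ≠ 0 ∧ A 0 1 = r * bvec ξm 0 ∧ A 1 1 = r * bvec ξm 1) ∧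
      ∀ H, RR H → (QuotientGroup.mk (A * H * A⁻¹) : PSL2) ∈ rightCrooked l := by
  obtain ⟨A, hA⟩ := geod_param γ hγ
  have hp := endpoint_vec A ξp (by simpa only [hA] using hξp)
  have hm' : Tendsto (fun t => embH (γ (-t))) atTop (𝓝 (toC ξm)) := hξm.comp tendsto_neg_atTop_atBot
  have hm := endpoint_vec (A * SS) ξm (by
    simpa only [hA, mul_smul, SS_ii] using hm')
  rw [mul_00, mul_10] at hm
  simp only [SS, mk2_00, mk2_10, mul_zero, mul_one, zero_add] at hm
  refine ⟨A, hA, hp, hm, ?_⟩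
  have hep : IsEndpoint l ξp := ⟨γ, hγ, hrange, hξp⟩
  have hem : IsEndpoint l ξm := by
    refine ⟨fun t => γ (-t), hγ.comp (IsometryEquiv.neg ℝ).isometry, ?_, hm'⟩
    rw [← hrange]
    exact (Equiv.neg ℝ).surjective.range_comp γ
  intro H hH
  set B := A * H * A⁻¹ with hB
  have hBA : B * A = A * H := by rw [hB]; group
  rcases hH with ⟨t, h⟩ | ⟨h1, h2⟩ | ⟨h1, h2⟩
  · left
    refine ⟨A • ii t, hrange ▸ ⟨t, hA t⟩, ?_⟩
    rw [pslSMul_mk, ← mul_smul, hBA, mul_smul, h]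
  · right
    obtain ⟨r, hr, e0, e1⟩ := hp
    refine ⟨ξp, hep, nonattr_of B ξp _ _ r (H 0 0) hr e0 e1 h2 ?_ ?_⟩
    · rw [← mul_00, hBA, mul_00, h1]; ring
    · rw [← mul_10, hBA, mul_10, h1]; ring
  · right
    obtain ⟨r, hr, e0, e1⟩ := hm
    refine ⟨ξm, hem, nonattr_of B ξm _ _ r (H 1 1) hr e0 e1 h2 ?_ ?_⟩
    · rw [← mul_01, hBA, mul_01, h1]; ring
    · rw [← mul_11, hBA, mul_11, h1]; ring

theorem stmt5 (γ γ' : ℝ → ℍ) (hγ : Isometry γ) (hγ' : Isometry γ')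
    (l l' : Set ℍ) (hrange : Set.range γ = l) (hrange' : Set.range γ' = l')
    (ξp ξm ξ'p ξ'm : OnePoint ℝ)
    (hξp : Tendsto (fun t => embH (γ t)) atTop (𝓝 (toC ξp)))
    (hξm : Tendsto (fun t => embH (γ t)) atBot (𝓝 (toC ξm)))
    (hξ'p : Tendsto (fun t => embH (γ' t)) atTop (𝓝 (toC ξ'p)))
    (hξ'm : Tendsto (fun t => embH (γ' t)) atBot (𝓝 (toC ξ'm)))
    (g g' : PSL2)
    (hdisj : Disjoint ((g * ·) '' rightCrooked l) ((g' * ·) '' rightCrooked l')) :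
    l ∩ l' = ∅ ∧ ({ξp, ξm} ∩ {ξ'p, ξ'm} : Set (OnePoint ℝ)) = ∅ := by
  obtain ⟨A, hA, ⟨r, hr, p0, p1⟩, ⟨s, hs, m0, m1⟩, hT⟩ :=
    transfer γ hγ l hrange ξp ξm hξp hξm
  obtain ⟨A', hA', ⟨r', hr', p0', p1'⟩, ⟨s', hs', m0', m1'⟩, hT'⟩ :=
    transfer γ' hγ' l' hrange' ξ'p ξ'm hξ'p hξ'm
  obtain ⟨G, rfl⟩ := QuotientGroup.mk_surjective g
  obtain ⟨G', rfl⟩ := QuotientGroup.mk_surjective g'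
  have hno : ¬ PP (A⁻¹ * A') (A⁻¹ * (G⁻¹ * G') * A') := by
    rintro ⟨H, H', h1, h2, h3⟩
    refine Set.disjoint_left.1 hdisj ⟨_, hT H h1, rfl⟩ ⟨_, hT' H' h2, ?_⟩
    change ((G' * (A' * H' * A'⁻¹) : SL2) : PSL2) = ((G * (A * H * A⁻¹) : SL2) : PSL2)
    congr 1
    calc G' * (A' * H' * A'⁻¹) = G * A * (A⁻¹ * (G⁻¹ * G') * A' * H') * A'⁻¹ := by group
      _ = G * (A * H * A⁻¹) := by rw [← h3]; group
  have hz : ∀ i j, (A⁻¹ * A') i j ≠ 0 := fun i j h => hno (zero_all _ _ i j h)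
  refine ⟨?_, ?_⟩
  · rw [Set.eq_empty_iff_forall_notMem]
    rintro x ⟨hx, hx'⟩
    rw [← hrange] at hx
    rw [← hrange'] at hx'
    obtain ⟨t, rfl⟩ := hx
    obtain ⟨u, hu⟩ := hx'
    rw [hA, hA'] at hu
    refine hno (point_case _ _ t u ?_)
    rw [mul_smul, hu, inv_smul_smul]
  · rw [Set.eq_empty_iff_forall_notMem]
    rintro x ⟨hx, hx'⟩
    simp only [Set.mem_insert_iff, Set.mem_singleton_iff] at hx hx'
    rcases hx with rfl | rfl <;> rcases hx' with rfl | rfl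
    · apply hz 1 0; rw [mul_10, inv_10, inv_11, p0, p1, p0', p1']; ring
    · apply hz 1 1; rw [mul_11, inv_10, inv_11, p0, p1, m0', m1']; ring
    · apply hz 0 0; rw [mul_00, inv_00, inv_01, m0, m1, p0', p1']; ring
    · apply hz 0 1; rw [mul_01, inv_00, inv_01, m0, m1, m0', m1']; ring
end
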